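/- arXiv:2402.08733 — 8 statements merged into one kernel-verified Lean document; each statement's English description precedes it below -/
import Mathlib

section
/- Suppose the predictor p̂ is first-order calibrated with some grouping function Φ : 𝒳 → 𝒵. Then p̂ is also first-order calibrated with the grouping function Φ^θ : 𝒳 → ℝ^𝒴 defined by Φ^θ(x) = (p̂(y|x))_{y∈𝒴}; that is, for all x ∈ 𝒳 and y ∈ 𝒴, p̂(y|x) = E[p(y|X) | X ∈ [x]_{Φ^θ}], where [x]_{Φ^θ} = {x' : p̂(·|x') = p̂(·|x)}. -/
open Finset

open scoped Classical

/-- Conditional expectation of `f(X)` given `X ∈ [x]_Φ`, where `X ∼ μ` on a finite set. -/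
noncomputable def groupExp {𝒳 𝒵 : Type*} [Fintype 𝒳] (μ : 𝒳 → ℝ) (Φ : 𝒳 → 𝒵)
    (f : 𝒳 → ℝ) (x : 𝒳) : ℝ :=
  (∑ x' : 𝒳, if Φ x' = Φ x then μ x' * f x' else 0) /
  (∑ x' : 𝒳, if Φ x' = Φ x then μ x' else 0)

theorem groupExp_congr {𝒳 𝒵 : Type*} [Fintype 𝒳] (μ : 𝒳 → ℝ) (Φ : 𝒳 → 𝒵) (f : 𝒳 → ℝ)
    {a b : 𝒳} (h : Φ a = Φ b) : groupExp μ Φ f a = groupExp μ Φ f b := by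
  simp only [groupExp, h]

theorem groupMass_pos {𝒳 𝒵 : Type*} [Fintype 𝒳] {μ : 𝒳 → ℝ} (hμ : ∀ x, 0 < μ x)
    (Φ : 𝒳 → 𝒵) (x : 𝒳) : 0 < ∑ x' : 𝒳, if Φ x' = Φ x then μ x' else 0 := by
  refine Finset.sum_pos' (fun a _ => ?_) ⟨x, Finset.mem_univ x, ?_⟩
  · split_ifs
    exacts [(hμ a).le, le_rfl]
  · simpa using hμ x

/-- Tower property: averaging `f` over a union of `Φ`-classes is the same as averaging its
conditional expectation given `Φ`. -/
theorem sum_mul_groupExp {𝒳 𝒵 : Type*} [Fintype 𝒳] {μ : 𝒳 → ℝ} (hμ : ∀ x, 0 < μ x)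
    (Φ : 𝒳 → 𝒵) (f : 𝒳 → ℝ) (P : 𝒳 → Prop) (hP : ∀ a b, Φ a = Φ b → (P a ↔ P b)) :
    (∑ a, if P a then μ a * groupExp μ Φ f a else 0) = ∑ a, if P a then μ a * f a else 0 := by
  have hswap : (∑ a, if P a then μ a * groupExp μ Φ f a else 0) =
      ∑ a, ∑ b, if Φ a = Φ b then
        (if P b then μ b * f b / (∑ c, if Φ c = Φ b then μ c else 0) else 0) * μ a else 0 := by
    refine Finset.sum_congr rfl fun a _ => ?_
    by_cases ha : P a
    · rw [if_pos ha, groupExp, Finset.sum_div, Finset.mul_sum]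
      refine Finset.sum_congr rfl fun b _ => ?_
      by_cases h : Φ a = Φ b
      · rw [if_pos h.symm, if_pos h, if_pos ((hP a b h).1 ha), h, mul_comm]
      · rw [if_neg (Ne.symm h), if_neg h, zero_div, mul_zero]
    · rw [if_neg ha]
      refine (Finset.sum_eq_zero fun b _ => ?_).symm
      by_cases h : Φ a = Φ b
      · rw [if_pos h, if_neg (fun hb => ha ((hP a b h).2 hb)), zero_mul]
      · rw [if_neg h]
  rw [hswap, Finset.sum_comm]
  refine Finset.sum_congr rfl fun b _ => ?_
  simp only [← mul_ite_zero, ← Finset.mul_sum]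
  by_cases hb : P b
  · rw [if_pos hb, if_pos hb]
    exact div_mul_cancel₀ _ (groupMass_pos hμ Φ b).ne'
  · rw [if_neg hb, if_neg hb, zero_mul, mul_zero]

/-- If `p̂` is first-order calibrated with some grouping function `Φ`,
then it is also first-order calibrated with the grouping function `x ↦ p̂(·|x)`. -/
theorem stmt_0 {𝒳 𝒴 𝒵 : Type*} [Fintype 𝒳] [Fintype 𝒴] [Nonempty 𝒳] [Nonempty 𝒴]
    (μ : 𝒳 → ℝ) (hμpos : ∀ x, 0 < μ x) (hμsum : ∑ x, μ x = 1)
    (p : 𝒳 → 𝒴 → ℝ) (hp0 : ∀ x y, 0 ≤ p x y) (hp1 : ∀ x, ∑ y, p x y = 1)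
    (phat : 𝒳 → 𝒴 → ℝ) (hphat0 : ∀ x y, 0 ≤ phat x y) (hphat1 : ∀ x, ∑ y, phat x y = 1)
    (Φ : 𝒳 → 𝒵)
    (hcal : ∀ x y, phat x y = groupExp μ Φ (fun x' => p x' y) x) :
    ∀ x y, phat x y = groupExp μ (fun x' => phat x') (fun x' => p x' y) x := by
  intro x y
  have hclass : ∀ a b, Φ a = Φ b → (phat a = phat x ↔ phat b = phat x) := fun a b h => by
    have hab : phat a = phat b := funext fun z => by
      rw [hcal a z, hcal b z, groupExp_congr μ Φ _ h]
    rw [hab]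
  rw [groupExp, eq_div_iff (groupMass_pos hμpos (fun x' => phat x') x).ne',
    ← sum_mul_groupExp hμpos Φ (fun x' => p x' y) (fun a => phat a = phat x) hclass,
    Finset.mul_sum]
  refine Finset.sum_congr rfl fun a _ => ?_
  by_cases h : phat a = phat x
  · rw [if_pos h, if_pos h, ← hcal a y, h, mul_comm]
  · rw [if_neg h, if_neg h, mul_zero]
end

section
/- If the pair predictor p̂₂ is pair-calibrated with grouping function Φ, then its pair covariance Σ̂(x)_{y,y'} := p̂₂(y,y'|x) − p̂₁(y|x)·p̂₁(y'|x) equals the conditional covariance of the true probabilities over the equivalence class: for all x, y, y', Σ̂(x)_{y,y'} = E[p(y|X)·p(y'|X) | X ∈ [x]_Φ] − E[p(y|X) | X ∈ [x]_Φ]·E[p(y'|X) | X ∈ [x]_Φ]. In particular, (p̂₁, Σ̂) is second-order calibrated with grouping function Φ. -/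
open Finset

open scoped Classical

/-- Marginal `p̂₁(y|x) = ∑_{y'} p̂₂(y,y'|x)` of a pair predictor. -/
noncomputable def marginal {𝒳 𝒴 : Type*} [Fintype 𝒴] (p2 : 𝒳 → 𝒴 → 𝒴 → ℝ) (x : 𝒳) (y : 𝒴) : ℝ :=
  ∑ y' : 𝒴, p2 x y y'

/-- Cheat-corrected epistemic variance `V̂(y|x) = p̂₂(y,y|x) − p̂₁(y|x)²`. -/
noncomputable def cheatVar {𝒳 𝒴 : Type*} [Fintype 𝒴] (p2 : 𝒳 → 𝒴 → 𝒴 → ℝ) (x : 𝒳) (y : 𝒴) : ℝ :=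
  p2 x y y - (marginal p2 x y) ^ 2

/-- Cheat-corrected epistemic confidence `C(y|x)`. -/
noncomputable def cheatConf {𝒳 𝒴 : Type*} [Fintype 𝒴] (p2 : 𝒳 → 𝒴 → 𝒴 → ℝ) (x : 𝒳) (y : 𝒴) : ℝ :=
  if 0 < p2 x y y then (marginal p2 x y) ^ 2 / p2 x y y else 0


/-- Conditional expectation over an equivalence class commutes with finite sums. -/
theorem groupExp_sum {𝒳 𝒵 ι : Type*} [Fintype 𝒳] (μ : 𝒳 → ℝ) (Φ : 𝒳 → 𝒵) (s : Finset ι)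
    (f : ι → 𝒳 → ℝ) (x : 𝒳) :
    groupExp μ Φ (fun x' => ∑ i ∈ s, f i x') x = ∑ i ∈ s, groupExp μ Φ (f i) x := by
  simp only [groupExp]
  rw [← Finset.sum_div, Finset.sum_comm]
  congr 1
  refine Finset.sum_congr rfl fun x' _ => ?_
  split_ifs <;> simp [Finset.mul_sum]

/-- The pair covariance of a pair-calibrated pair predictor equals the
conditional covariance of the true probabilities over the equivalence class; in particular
the marginal and pair covariance are second-order calibrated. -/
theorem stmt_2 {𝒳 𝒴 𝒵 : Type*} [Fintype 𝒳] [Fintype 𝒴] [Nonempty 𝒳] [Nonempty 𝒴]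
    (μ : 𝒳 → ℝ) (hμpos : ∀ x, 0 < μ x) (hμsum : ∑ x, μ x = 1)
    (p : 𝒳 → 𝒴 → ℝ) (hp0 : ∀ x y, 0 ≤ p x y) (hp1 : ∀ x, ∑ y, p x y = 1)
    (p2 : 𝒳 → 𝒴 → 𝒴 → ℝ)
    (hp20 : ∀ x y₁ y₂, 0 ≤ p2 x y₁ y₂) (hp21 : ∀ x, ∑ y₁, ∑ y₂, p2 x y₁ y₂ = 1)
    (Φ : 𝒳 → 𝒵)
    (hcal : ∀ x y₁ y₂, p2 x y₁ y₂ = groupExp μ Φ (fun x' => p x' y₁ * p x' y₂) x) :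
    (∀ x y y', p2 x y y' - marginal p2 x y * marginal p2 x y' =
        groupExp μ Φ (fun x' => p x' y * p x' y') x -
          groupExp μ Φ (fun x' => p x' y) x * groupExp μ Φ (fun x' => p x' y') x) ∧
    (∀ x y, marginal p2 x y = groupExp μ Φ (fun x' => p x' y) x) := by
  have hmarg : ∀ x y, marginal p2 x y = groupExp μ Φ (fun x' => p x' y) x := by
    intro x y
    simp only [marginal, hcal, ← groupExp_sum, ← Finset.mul_sum, hp1, mul_one]
  refine ⟨fun x y y' => ?_, hmarg⟩
  rw [hmarg, hmarg, hcal]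
end

section
/- If (p̂, Σ̂) is second-order calibrated with grouping function Φ, then the function q defined by q(y₁,y₂|x) = Σ̂(x)_{y₁,y₂} + p̂(y₁|x)·p̂(y₂|x) is a pair predictor (for each x, q(·,·|x) is a probability mass function on 𝒴 × 𝒴) that is pair-calibrated with grouping function Φ; moreover its marginal ∑_{y'} q(y,y'|x) equals p̂(y|x) and its pair covariance q(y,y'|x) − p̂(y|x)·p̂(y'|x) equals Σ̂(x)_{y,y'}. -/
open Finset

open scoped Classical

theorem groupExp_nonneg {𝒳 𝒵 : Type*} [Fintype 𝒳] {μ : 𝒳 → ℝ} (hμ : ∀ x, 0 ≤ μ x)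
    (Φ : 𝒳 → 𝒵) {f : 𝒳 → ℝ} (hf : ∀ x, 0 ≤ f x) (x : 𝒳) : 0 ≤ groupExp μ Φ f x := by
  unfold groupExp
  refine div_nonneg (sum_nonneg fun x' _ => ?_) (sum_nonneg fun x' _ => ?_)
  · split_ifs
    exacts [mul_nonneg (hμ x') (hf x'), le_rfl]
  · split_ifs
    exacts [hμ x', le_rfl]

theorem sum_groupExp {𝒳 𝒵 ι : Type*} [Fintype 𝒳] [Fintype ι] (μ : 𝒳 → ℝ)
    (Φ : 𝒳 → 𝒵) (f : ι → 𝒳 → ℝ) (x : 𝒳) :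
    ∑ i, groupExp μ Φ (f i) x = groupExp μ Φ (fun x' => ∑ i, f i x') x := by
  unfold groupExp
  rw [← sum_div, sum_comm]
  congr 1
  refine sum_congr rfl fun x' _ => ?_
  split_ifs
  · rw [mul_sum]
  · exact sum_const_zero

/-- From a second-order calibrated pair `(p̂, Σ̂)` one can build a
pair-calibrated pair predictor `q(y₁,y₂|x) = Σ̂(x)_{y₁,y₂} + p̂(y₁|x)·p̂(y₂|x)`, whose
marginal is `p̂` and whose pair covariance is `Σ̂`. -/
theorem stmt_3 {𝒳 𝒴 𝒵 : Type*} [Fintype 𝒳] [Fintype 𝒴] [Nonempty 𝒳] [Nonempty 𝒴]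
    (μ : 𝒳 → ℝ) (hμpos : ∀ x, 0 < μ x) (hμsum : ∑ x, μ x = 1)
    (p : 𝒳 → 𝒴 → ℝ) (hp0 : ∀ x y, 0 ≤ p x y) (hp1 : ∀ x, ∑ y, p x y = 1)
    (phat : 𝒳 → 𝒴 → ℝ)
    (hphat0 : ∀ x y, 0 ≤ phat x y) (hphat1 : ∀ x, ∑ y, phat x y = 1)
    (Sighat : 𝒳 → 𝒴 → 𝒴 → ℝ)
    (Φ : 𝒳 → 𝒵)
    (hso1 : ∀ x y, phat x y = groupExp μ Φ (fun x' => p x' y) x)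
    (hso2 : ∀ x y y', Sighat x y y' =
      groupExp μ Φ (fun x' => p x' y * p x' y') x - phat x y * phat x y') :
    (∀ x y₁ y₂, 0 ≤ Sighat x y₁ y₂ + phat x y₁ * phat x y₂) ∧
    (∀ x, ∑ y₁, ∑ y₂, (Sighat x y₁ y₂ + phat x y₁ * phat x y₂) = 1) ∧
    (∀ x y₁ y₂, Sighat x y₁ y₂ + phat x y₁ * phat x y₂ =
      groupExp μ Φ (fun x' => p x' y₁ * p x' y₂) x) ∧
    (∀ x y, ∑ y', (Sighat x y y' + phat x y * phat x y') = phat x y) ∧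
    (∀ x y y', (Sighat x y y' + phat x y * phat x y') - phat x y * phat x y' = Sighat x y y') := by
  have hq : ∀ x y₁ y₂, Sighat x y₁ y₂ + phat x y₁ * phat x y₂ =
      groupExp μ Φ (fun x' => p x' y₁ * p x' y₂) x := fun x y₁ y₂ => by
    rw [hso2, sub_add_cancel]
  have hmarg : ∀ x y, ∑ y', (Sighat x y y' + phat x y * phat x y') = phat x y := fun x y => by
    simp only [hq, sum_groupExp, ← mul_sum, hp1, mul_one, ← hso1]
  refine ⟨fun x y₁ y₂ => ?_, fun x => ?_, hq, hmarg, fun x y y' => add_sub_cancel_right _ _⟩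
  · rw [hq]
    exact groupExp_nonneg (fun x' => (hμpos x').le) Φ
      (fun x' => mul_nonneg (hp0 x' y₁) (hp0 x' y₂)) x
  · simp only [hmarg, hphat1]
end

section
/- Suppose the pair predictor p̂₂ is pair-calibrated with grouping function Φ. Then for every x ∈ 𝒳, y ∈ 𝒴, and β ∈ (0,1), the conditional probability over the equivalence class satisfies P[ |p̂₁(y|x) − p(y|X)| > sqrt(V̂(y|x)/β) | X ∈ [x]_Φ ] ≤ β, where the conditional probability of a set S ⊆ 𝒳 given X ∈ [x]_Φ is (∑_{x' ∈ S ∩ [x]_Φ} μ(x')) / (∑_{x' ∈ [x]_Φ} μ(x')). -/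
open Finset

open scoped Classical

/-- A real number below which `√t` lies strictly in absolute value has square above `t`. -/
theorem lt_sq_of_sqrt_lt_abs {t d : ℝ} (h : √t < |d|) : t < d ^ 2 := by
  rw [← sq_abs]
  exact Real.lt_sq_of_sqrt_lt h

/-- Chebyshev's inequality for finitely many nonnegative weights `w` of positive total mass,
in the form that also covers zero variance. -/
theorem sum_weight_deviation_le {ι : Type*} [Fintype ι] {w d : ι → ℝ} (hw : ∀ i, 0 ≤ w i)
    {V β : ℝ} (hβ : 0 < β) (hW : 0 < ∑ i, w i)
    (hV : ∑ i, w i * d i ^ 2 = (∑ i, w i) * V) :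
    ∑ i, (if √(V / β) < |d i| then w i else 0) ≤ β * ∑ i, w i := by
  have hterm : ∀ i ∈ univ, 0 ≤ w i * d i ^ 2 := fun i _ => mul_nonneg (hw i) (sq_nonneg _)
  have hV0 : 0 ≤ V := nonneg_of_mul_nonneg_right (hV ▸ sum_nonneg hterm) hW
  rcases hV0.eq_or_lt with rfl | hVpos
  · rw [mul_zero, sum_eq_zero_iff_of_nonneg hterm] at hV
    rw [sum_eq_zero]
    · positivity
    · intro i hi
      split_ifs with h
      · have hd := lt_sq_of_sqrt_lt_abs h
        rw [zero_div] at hd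
        exact (mul_eq_zero.mp (hV i hi)).resolve_right hd.ne'
      · rfl
  · have key : (∑ i, if √(V / β) < |d i| then w i else 0) * (V / β) ≤ (∑ i, w i) * V := by
      rw [← hV, sum_mul]
      refine sum_le_sum fun i hi => ?_
      split_ifs with h
      · exact mul_le_mul_of_nonneg_left (lt_sq_of_sqrt_lt_abs h).le (hw i)
      · simpa using hterm i hi
    refine le_of_mul_le_mul_right (key.trans_eq ?_) (div_pos hVpos hβ)
    field_simp

/-- The marginal of a pair-calibrated predictor is the group average of the true conditional. -/
theorem marginal_eq_groupExp {𝒳 𝒴 𝒵 : Type*} [Fintype 𝒳] [Fintype 𝒴] {μ : 𝒳 → ℝ}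
    {p : 𝒳 → 𝒴 → ℝ} (hp1 : ∀ x, ∑ y, p x y = 1) {p2 : 𝒳 → 𝒴 → 𝒴 → ℝ} {Φ : 𝒳 → 𝒵}
    (hcal : ∀ x y₁ y₂, p2 x y₁ y₂ = groupExp μ Φ (fun x' => p x' y₁ * p x' y₂) x)
    (x : 𝒳) (y : 𝒴) : marginal p2 x y = groupExp μ Φ (fun x' => p x' y) x := by
  simp only [marginal, hcal, groupExp]
  rw [← sum_div, sum_comm]
  congr 1
  refine sum_congr rfl fun x' _ => ?_
  split_ifs
  · rw [← mul_sum, ← mul_sum, hp1, mul_one]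
  · exact sum_const_zero

/-- Chebyshev-style confidence interval for the true conditional
probability over the equivalence class, for a pair-calibrated pair predictor. -/
theorem stmt_7 {𝒳 𝒴 𝒵 : Type*} [Fintype 𝒳] [Fintype 𝒴] [Nonempty 𝒳] [Nonempty 𝒴]
    (μ : 𝒳 → ℝ) (hμpos : ∀ x, 0 < μ x) (hμsum : ∑ x, μ x = 1)
    (p : 𝒳 → 𝒴 → ℝ) (hp0 : ∀ x y, 0 ≤ p x y) (hp1 : ∀ x, ∑ y, p x y = 1)
    (p2 : 𝒳 → 𝒴 → 𝒴 → ℝ)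
    (hp20 : ∀ x y₁ y₂, 0 ≤ p2 x y₁ y₂) (hp21 : ∀ x, ∑ y₁, ∑ y₂, p2 x y₁ y₂ = 1)
    (Φ : 𝒳 → 𝒵)
    (hcal : ∀ x y₁ y₂, p2 x y₁ y₂ = groupExp μ Φ (fun x' => p x' y₁ * p x' y₂) x) :
    ∀ (x : 𝒳) (y : 𝒴) (β : ℝ), 0 < β → β < 1 →
      (∑ x' : 𝒳, if Φ x' = Φ x ∧
            Real.sqrt (cheatVar p2 x y / β) < |marginal p2 x y - p x' y|
          then μ x' else 0) /
        (∑ x' : 𝒳, if Φ x' = Φ x then μ x' else 0) ≤ β := by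
  intro x y β hβ _
  set w : 𝒳 → ℝ := fun x' => if Φ x' = Φ x then μ x' else 0 with hw_def
  have hw : ∀ x', 0 ≤ w x' := fun x' => by
    simp only [hw_def]
    split_ifs
    exacts [(hμpos x').le, le_rfl]
  have hW : 0 < ∑ x', w x' :=
    sum_pos' (fun x' _ => hw x') ⟨x, mem_univ x, by simpa [hw_def] using hμpos x⟩
  have hexp : ∀ f : 𝒳 → ℝ, ∑ x', w x' * f x' = (∑ x', w x') * groupExp μ Φ f x := fun f => by
    have hf : groupExp μ Φ f x = (∑ x', w x' * f x') / ∑ x', w x' := by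
      simp only [groupExp, hw_def, ite_mul, zero_mul]
    rw [hf, mul_div_cancel₀ _ hW.ne']
  have hV : ∑ x', w x' * (marginal p2 x y - p x' y) ^ 2 = (∑ x', w x') * cheatVar p2 x y := by
    have h1 := hexp fun x' => p x' y
    have h2 := hexp fun x' => p x' y * p x' y
    rw [← marginal_eq_groupExp hp1 hcal] at h1
    rw [← hcal] at h2
    have hsplit : ∀ x', w x' * (marginal p2 x y - p x' y) ^ 2 =
        w x' * marginal p2 x y ^ 2 - 2 * marginal p2 x y * (w x' * p x' y) +
          w x' * (p x' y * p x' y) := fun x' => by ring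
    simp only [hsplit, sum_add_distrib, sum_sub_distrib, ← mul_sum, ← sum_mul]
    rw [h1, h2, cheatVar]
    ring
  rw [div_le_iff₀ hW]
  refine le_of_eq_of_le (sum_congr rfl fun x' _ => ?_) (sum_weight_deviation_le hw hβ hW hV)
  simp only [and_comm (a := Φ x' = Φ x), ite_and, hw_def]
end

section
/- Suppose the pair predictor p̂₂ is pair-calibrated with grouping function Φ. Then for every x ∈ 𝒳 and y ∈ 𝒴, the conditional probability that the response y is a statistical hallucination over the equivalence class is bounded by one minus the cheat-corrected epistemic confidence: P[ p(y|X) = 0 | X ∈ [x]_Φ ] ≤ 1 − C(y|x), where the conditional probability of a set S ⊆ 𝒳 given X ∈ [x]_Φ is (∑_{x' ∈ S ∩ [x]_Φ} μ(x')) / (∑_{x' ∈ [x]_Φ} μ(x')). -/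
open Finset

open scoped Classical

/-- Cauchy–Schwarz restricted to the support of `f`. -/
theorem sq_sum_mul_le_sum_support_mul_sum {ι : Type*} [Fintype ι] {w : ι → ℝ}
    (hw : ∀ i, 0 ≤ w i) (f : ι → ℝ) :
    (∑ i, w i * f i) ^ 2 ≤ (∑ i, if f i = 0 then 0 else w i) * ∑ i, w i * (f i * f i) := by
  refine Finset.sum_sq_le_sum_mul_sum_of_sq_le_mul _ (fun i _ => ?_)
    (fun i _ => mul_nonneg (hw i) (mul_self_nonneg _)) fun i _ => ?_
  · split_ifs
    exacts [le_rfl, hw i]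
  · split_ifs with h
    · simp [h]
    · exact le_of_eq (by ring)

/-- For a pair-calibrated pair predictor, the conditional probability
over the equivalence class that `y` is a statistical hallucination is at most
`1 − C(y|x)`. -/
theorem stmt_11 {𝒳 𝒴 𝒵 : Type*} [Fintype 𝒳] [Fintype 𝒴] [Nonempty 𝒳] [Nonempty 𝒴]
    (μ : 𝒳 → ℝ) (hμpos : ∀ x, 0 < μ x) (hμsum : ∑ x, μ x = 1)
    (p : 𝒳 → 𝒴 → ℝ) (hp0 : ∀ x y, 0 ≤ p x y) (hp1 : ∀ x, ∑ y, p x y = 1)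
    (p2 : 𝒳 → 𝒴 → 𝒴 → ℝ)
    (hp20 : ∀ x y₁ y₂, 0 ≤ p2 x y₁ y₂) (hp21 : ∀ x, ∑ y₁, ∑ y₂, p2 x y₁ y₂ = 1)
    (Φ : 𝒳 → 𝒵)
    (hcal : ∀ x y₁ y₂, p2 x y₁ y₂ = groupExp μ Φ (fun x' => p x' y₁ * p x' y₂) x) :
    ∀ x y,
      (∑ x' : 𝒳, if Φ x' = Φ x ∧ p x' y = 0 then μ x' else 0) /
        (∑ x' : 𝒳, if Φ x' = Φ x then μ x' else 0) ≤ 1 - cheatConf p2 x y := by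
  intro x y
  set w : 𝒳 → ℝ := fun x' => if Φ x' = Φ x then μ x' else 0 with hw_def
  have hw : ∀ x', 0 ≤ w x' := fun x' => by
    simp only [hw_def]
    split_ifs
    exacts [(hμpos x').le, le_rfl]
  have hW : 0 < ∑ x', w x' :=
    Finset.sum_pos' (fun x' _ => hw x') ⟨x, Finset.mem_univ x, by simp [hw_def, hμpos]⟩
  have hexp : ∀ f : 𝒳 → ℝ, groupExp μ Φ f x = (∑ x', w x' * f x') / ∑ x', w x' := fun f => by
    simp only [groupExp, hw_def, ite_mul, zero_mul]
  have hsplit : (∑ x', if Φ x' = Φ x ∧ p x' y = 0 then μ x' else 0) +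
      (∑ x', if p x' y = 0 then 0 else w x') = ∑ x', w x' := by
    rw [← Finset.sum_add_distrib]
    refine Finset.sum_congr rfl fun x' _ => ?_
    by_cases h1 : Φ x' = Φ x <;> by_cases h2 : p x' y = 0 <;> simp [hw_def, h1, h2]
  have hN : 0 ≤ ∑ x', if p x' y = 0 then 0 else w x' := Finset.sum_nonneg fun x' _ => by
    split_ifs
    exacts [le_rfl, hw x']
  have hCS := sq_sum_mul_le_sum_support_mul_sum hw fun x' => p x' y
  have hC : cheatConf p2 x y ≤ (∑ x', if p x' y = 0 then 0 else w x') / ∑ x', w x' := by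
    unfold cheatConf
    split_ifs with hpos
    · rw [div_le_iff₀ hpos, marginal_eq_groupExp hp1 hcal, hcal, hexp, hexp, div_pow,
        div_mul_div_comm, ← sq]
      exact div_le_div_of_nonneg_right hCS (sq_nonneg _)
    · exact div_nonneg hN hW.le
  have hdiv := congrArg (· / ∑ x', w x') hsplit
  simp only [add_div, div_self hW.ne'] at hdiv
  linarith
end

section
/- Let (Xᵢ, Y₁ᵢ, Y₂ᵢ) for i = 1,…,N be i.i.d. calibration samples, where Xᵢ ∼ μ and, conditionally on Xᵢ = x, Y₁ᵢ and Y₂ᵢ are independent {0,1}-valued with success probability p(1|x). Define sᵢ = (Y₁ᵢ − p̂(Xᵢ))·(Y₂ᵢ − p̂(Xᵢ)) / max{V̂(Xᵢ), ε} and, for α ∈ (0,1), γ⁺ = (1/N)·∑_{i=1}^N sᵢ + sqrt(2·ln(1/α)/(N·ε²)). Then with probability at least 1 − α over the draw of the calibration samples, the following holds: for every β ∈ (0,1), P_{X∼μ}[ |p̂(X) − p(1|X)| > sqrt( γ⁺ · max{V̂(X), ε} / β ) ] ≤ β. -/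
open Finset

open scoped Classical

open MeasureTheory ProbabilityTheory in
/-- One-sided Hoeffding bound for the empirical mean of `N` i.i.d. samples of a function with
values in `[-1/ε, 1/ε]`, as an upper confidence bound of level `1 - α` for its expectation. -/
theorem ofReal_one_sub_le_pi_integral_le_empirical_mean_add {Ω : Type*} [MeasurableSpace Ω]
    (ν : Measure Ω) [IsProbabilityMeasure ν] {f : Ω → ℝ} (hf : Measurable f) {ε : ℝ} (hε : 0 < ε)
    (hfε : ∀ z, f z ∈ Set.Icc (-(1 / ε)) (1 / ε)) {N : ℕ} (hN : 0 < N)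
    {α : ℝ} (hα0 : 0 < α) (hα1 : α < 1) :
    ENNReal.ofReal (1 - α) ≤ Measure.pi (fun _ : Fin N => ν)
      {ω | ∫ z, f z ∂ν ≤ 1 / (N : ℝ) * ∑ i, f (ω i) +
        Real.sqrt (2 * Real.log (1 / α) / ((N : ℝ) * ε ^ 2))} := by
  set m := ∫ z, f z ∂ν with hm
  set t := Real.sqrt (2 * Real.log (1 / α) / ((N : ℝ) * ε ^ 2)) with ht
  set P := Measure.pi (fun _ : Fin N => ν)
  have hNpos : (0 : ℝ) < N := by exact_mod_cast hN
  have ht0 : 0 ≤ t := Real.sqrt_nonneg _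
  have hlog : 0 ≤ Real.log (1 / α) := Real.log_nonneg (by rw [le_div_iff₀ hα0]; linarith)
  have hindep : iIndepFun (fun (i : Fin N) (ω : Fin N → Ω) => -(f (ω i) - m)) P :=
    iIndepFun_pi (X := fun _ z => -(f z - m)) fun _ => (hf.sub_const m).neg.aemeasurable
  have hsub (i : Fin N) : HasSubgaussianMGF (fun ω : Fin N → Ω => -(f (ω i) - m))
      ((‖1 / ε - -(1 / ε)‖₊ / 2) ^ 2) P := by
    have hmp := measurePreserving_eval (fun _ : Fin N => ν) i
    have h : HasSubgaussianMGF (fun z => -(f z - m)) ((‖1 / ε - -(1 / ε)‖₊ / 2) ^ 2) ν :=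
      (hasSubgaussianMGF_of_mem_Icc hf.aemeasurable (Filter.Eventually.of_forall hfε)).neg
    exact HasSubgaussianMGF.of_map (Y := Function.eval i) hmp.aemeasurable (hmp.map_eq ▸ h)
  have htail := HasSubgaussianMGF.measure_sum_ge_le_of_iIndepFun hindep
    (s := Finset.univ) (fun i _ => hsub i) (ε := N * t) (by positivity)
  have hexp : Real.exp (-(N * t) ^ 2 / (2 * ((∑ _i : Fin N,
      (‖1 / ε - -(1 / ε)‖₊ / 2) ^ 2 : NNReal) : ℝ))) = α := by
    have hc : ((∑ _i : Fin N, (‖1 / ε - -(1 / ε)‖₊ / 2) ^ 2 : NNReal) : ℝ)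
        = N * (1 / ε) ^ 2 := by
      have : |1 / ε - -(1 / ε)| = 2 * (1 / ε) := by
        rw [abs_of_nonneg (by rw [sub_neg_eq_add]; positivity)]; ring
      push_cast
      rw [Real.norm_eq_abs, this]
      simp
    have ht2 : t ^ 2 = 2 * Real.log (1 / α) / ((N : ℝ) * ε ^ 2) := Real.sq_sqrt (by positivity)
    have : -(N * t) ^ 2 / (2 * (N * (1 / ε) ^ 2)) = -Real.log (1 / α) := by
      rw [mul_pow, ht2]
      field_simp
    rw [hc, this, one_div, Real.log_inv, neg_neg, Real.exp_log hα0]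
  rw [hexp] at htail
  have hmeas : MeasurableSet {ω : Fin N → Ω | m ≤ 1 / (N : ℝ) * ∑ i, f (ω i) + t} :=
    measurableSet_le measurable_const (by fun_prop)
  have hcompl : P.real {ω : Fin N → Ω | m ≤ 1 / (N : ℝ) * ∑ i, f (ω i) + t}ᶜ ≤ α := by
    refine (measureReal_mono fun ω hω => ?_).trans htail
    simp only [Set.mem_compl_iff, Set.mem_ofPred_eq, not_le] at hω ⊢
    rw [Finset.sum_neg_distrib, Finset.sum_sub_distrib]
    simp only [Finset.sum_const, Finset.card_univ, Fintype.card_fin, nsmul_eq_mul]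
    have := mul_lt_mul_of_pos_left hω hNpos
    rw [mul_add, ← mul_assoc, mul_one_div_cancel hNpos.ne', one_mul] at this
    linarith
  rw [probReal_compl_eq_one_sub hmeas] at hcompl
  rw [← ofReal_measureReal]
  exact ENNReal.ofReal_le_ofReal (by linarith)

/-- Chebyshev-type inequality on a finite space: if `γ` bounds the mean of `d ^ 2 / M`, then
`|d| > sqrt (γ * M / β)` has weight at most `β`. -/
theorem sum_ite_sqrt_lt_abs_le {ι : Type*} [Fintype ι] {w d M : ι → ℝ} (hw : ∀ x, 0 < w x)
    (hM : ∀ x, 0 < M x) {γ β : ℝ} (hγ : ∑ x, w x * (d x ^ 2 / M x) ≤ γ) (hβ : 0 < β) :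
    (∑ x, if Real.sqrt (γ * M x / β) < |d x| then w x else 0) ≤ β := by
  have hterm (x : ι) : 0 ≤ w x * (d x ^ 2 / M x) :=
    mul_nonneg (hw x).le (div_nonneg (sq_nonneg _) (hM x).le)
  have hγ0 : 0 ≤ γ := (Finset.sum_nonneg fun x _ => hterm x).trans hγ
  have hlt {x : ι} (hx : Real.sqrt (γ * M x / β) < |d x|) : γ / β < d x ^ 2 / M x := by
    rw [Real.sqrt_lt' ((Real.sqrt_nonneg _).trans_lt hx), sq_abs] at hx
    rw [lt_div_iff₀ (hM x)]
    calc γ / β * M x = γ * M x / β := by ring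
      _ < d x ^ 2 := hx
  rcases hγ0.eq_or_lt with rfl | hγpos
  · refine (Finset.sum_nonpos fun x _ => ?_).trans hβ.le
    split_ifs with hx
    · have h1 := hlt hx
      rw [zero_div] at h1
      have h2 := Finset.single_le_sum (fun y _ => hterm y) (Finset.mem_univ x)
      exact absurd (h2.trans hγ) (mul_pos (hw x) h1).not_ge
    · exact le_rfl
  · have h : (∑ x, if Real.sqrt (γ * M x / β) < |d x| then w x else 0) * (γ / β) ≤ γ := by
      rw [Finset.sum_mul]
      refine (Finset.sum_le_sum fun x _ => ?_).trans hγ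
      split_ifs with hx
      · exact mul_le_mul_of_nonneg_left (hlt hx).le (hw x).le
      · simpa using hterm x
    rw [← mul_div_assoc, div_le_iff₀ hβ, mul_comm γ β] at h
    exact le_of_mul_le_mul_right h hγpos

theorem mul_div_max_mem_Icc {a b v ε : ℝ} (ha : |a| ≤ 1) (hb : |b| ≤ 1) (hε : 0 < ε) :
    a * b / max v ε ∈ Set.Icc (-(1 / ε)) (1 / ε) := by
  rw [Set.mem_Icc, ← abs_le, abs_div, abs_mul, abs_of_pos (hε.trans_le (le_max_right v ε))]
  exact div_le_div₀ zero_le_one (mul_le_one₀ ha (abs_nonneg b) hb) hε (le_max_right v ε)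

theorem abs_ite_one_zero_sub_le_one {p : ℝ} (hp : p ∈ Set.Icc (0 : ℝ) 1) (b : Bool) :
    |(if b then (1 : ℝ) else 0) - p| ≤ 1 := by
  obtain ⟨h0, h1⟩ := hp
  rw [abs_le]
  cases b <;> constructor <;> simp <;> linarith

/-- Hoeffding-based conservative adjustment: drawing `N` i.i.d.
calibration triples `(Xᵢ, Y₁ᵢ, Y₂ᵢ)` (each `Xᵢ ∼ μ`, and given `Xᵢ = x` the responses are
independent Bernoulli with success probability `p(1|x)`), the empirical bound
`γ⁺ = (1/N)∑ᵢ sᵢ + sqrt(2·ln(1/α)/(N·ε²))` yields, with probability at least `1 − α`,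
valid Chebyshev-style confidence intervals for every `β ∈ (0,1)`. Each calibration-set
sample is a tuple in `𝒳 × Bool × Bool`, where `true` encodes the response `1` and `false`
the response `0`; the calibration set is distributed according to the `N`-fold product of
the single-sample measure `ν`. -/
theorem stmt_16 {𝒳 : Type*} [Fintype 𝒳] [Nonempty 𝒳]
    [MeasurableSpace 𝒳] [MeasurableSingletonClass 𝒳]
    (μ : 𝒳 → ℝ) (hμpos : ∀ x, 0 < μ x) (hμsum : ∑ x, μ x = 1)
    (ptrue : 𝒳 → ℝ) (hptrue : ∀ x, ptrue x ∈ Set.Icc (0 : ℝ) 1)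
    (phat : 𝒳 → ℝ) (hphat : ∀ x, phat x ∈ Set.Icc (0 : ℝ) 1)
    (Vhat : 𝒳 → ℝ) (ε : ℝ) (hε : 0 < ε)
    (N : ℕ) (hN : 0 < N)
    (ν : MeasureTheory.Measure (𝒳 × Bool × Bool)) [MeasureTheory.IsProbabilityMeasure ν]
    (hν : ∀ (x : 𝒳) (i j : Bool),
      ν {(x, i, j)} = ENNReal.ofReal (μ x * (if i then ptrue x else 1 - ptrue x) *
        (if j then ptrue x else 1 - ptrue x)))
    (α : ℝ) (hα0 : 0 < α) (hα1 : α < 1) :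
    ENNReal.ofReal (1 - α) ≤
      MeasureTheory.Measure.pi (fun _ : Fin N => ν)
        {ω : Fin N → 𝒳 × Bool × Bool |
          ∀ β : ℝ, 0 < β → β < 1 →
            (∑ x : 𝒳, if Real.sqrt
                  ((1 / (N : ℝ) * ∑ i : Fin N,
                      ((if (ω i).2.1 then (1 : ℝ) else 0) - phat (ω i).1) *
                        ((if (ω i).2.2 then (1 : ℝ) else 0) - phat (ω i).1) /
                          max (Vhat (ω i).1) ε
                    + Real.sqrt (2 * Real.log (1 / α) / ((N : ℝ) * ε ^ 2))) *
                    max (Vhat x) ε / β)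
                  < |phat x - ptrue x|
              then μ x else 0) ≤ β} := by
  set f : 𝒳 × Bool × Bool → ℝ := fun z =>
    ((if z.2.1 then (1 : ℝ) else 0) - phat z.1) * ((if z.2.2 then (1 : ℝ) else 0) - phat z.1) /
      max (Vhat z.1) ε with hf
  have hint : ∫ z, f z ∂ν = ∑ x, μ x * ((phat x - ptrue x) ^ 2 / max (Vhat x) ε) := by
    have hνreal (x : 𝒳) (i j : Bool) : ν.real {(x, i, j)} =
        μ x * (if i then ptrue x else 1 - ptrue x) * (if j then ptrue x else 1 - ptrue x) := by
      have hcond (b : Bool) : 0 ≤ if b then ptrue x else 1 - ptrue x := by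
        split_ifs
        exacts [(hptrue x).1, sub_nonneg.2 (hptrue x).2]
      rw [MeasureTheory.measureReal_def, hν, ENNReal.toReal_ofReal
        (mul_nonneg (mul_nonneg (hμpos x).le (hcond i)) (hcond j))]
    rw [MeasureTheory.integral_fintype (.of_finite), Fintype.sum_prod_type]
    refine Finset.sum_congr rfl fun x _ => ?_
    simp only [Fintype.sum_prod_type, Fintype.sum_bool, hνreal, hf, smul_eq_mul, if_true,
      Bool.false_eq_true, if_false]
    ring
  refine (ofReal_one_sub_le_pi_integral_le_empirical_mean_add ν (measurable_of_finite f) hε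
    (fun z => mul_div_max_mem_Icc (abs_ite_one_zero_sub_le_one (hphat z.1) z.2.1)
      (abs_ite_one_zero_sub_le_one (hphat z.1) z.2.2) hε) hN hα0 hα1).trans
    (MeasureTheory.measure_mono fun ω hω β hβ _ => ?_)
  rw [Set.mem_ofPred_eq, hint] at hω
  exact sum_ite_sqrt_lt_abs_le hμpos (fun x => hε.trans_le (le_max_right (Vhat x) ε)) hω hβ
end

section
/- If the pair predictor p̂₂ is pair-calibrated with some grouping function Φ, then for every x ∈ 𝒳: (a) p̂₂ is symmetric, i.e. p̂₂(y₁,y₂|x) = p̂₂(y₂,y₁|x) for all y₁, y₂ ∈ 𝒴; and (b) the joint probability matrix is positive semidefinite, i.e. for every vector v : 𝒴 → ℝ, ∑_{y₁∈𝒴} ∑_{y₂∈𝒴} v(y₁)·p̂₂(y₁,y₂|x)·v(y₂) ≥ 0. -/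
open Finset

open scoped Classical

theorem groupExp_const_mul {𝒳 𝒵 : Type*} [Fintype 𝒳] (μ : 𝒳 → ℝ) (Φ : 𝒳 → 𝒵)
    (c : ℝ) (f : 𝒳 → ℝ) (x : 𝒳) :
    groupExp μ Φ (fun x' => c * f x') x = c * groupExp μ Φ f x := by
  simp only [groupExp, ← mul_div_assoc, mul_sum, mul_ite, mul_zero, mul_left_comm]

/-- The joint probability matrix of a pair-calibrated pair predictor is
symmetric and positive semidefinite. -/
theorem stmt_17 {𝒳 𝒴 𝒵 : Type*} [Fintype 𝒳] [Fintype 𝒴] [Nonempty 𝒳] [Nonempty 𝒴]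
    (μ : 𝒳 → ℝ) (hμpos : ∀ x, 0 < μ x) (hμsum : ∑ x, μ x = 1)
    (p : 𝒳 → 𝒴 → ℝ) (hp0 : ∀ x y, 0 ≤ p x y) (hp1 : ∀ x, ∑ y, p x y = 1)
    (p2 : 𝒳 → 𝒴 → 𝒴 → ℝ)
    (hp20 : ∀ x y₁ y₂, 0 ≤ p2 x y₁ y₂) (hp21 : ∀ x, ∑ y₁, ∑ y₂, p2 x y₁ y₂ = 1)
    (Φ : 𝒳 → 𝒵)
    (hcal : ∀ x y₁ y₂, p2 x y₁ y₂ = groupExp μ Φ (fun x' => p x' y₁ * p x' y₂) x) :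
    ∀ x : 𝒳,
      (∀ y₁ y₂, p2 x y₁ y₂ = p2 x y₂ y₁) ∧
      (∀ v : 𝒴 → ℝ, 0 ≤ ∑ y₁ : 𝒴, ∑ y₂ : 𝒴, v y₁ * p2 x y₁ y₂ * v y₂) := by
  intro x
  refine ⟨fun y₁ y₂ => by simp only [hcal, mul_comm], fun v => ?_⟩
  have hquad : ∑ y₁ : 𝒴, ∑ y₂ : 𝒴, v y₁ * p2 x y₁ y₂ * v y₂ =
      groupExp μ Φ (fun x' => (∑ y, v y * p x' y) ^ 2) x := by
    simp only [sq, sum_mul_sum, groupExp_sum]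
    refine sum_congr rfl fun y₁ _ => sum_congr rfl fun y₂ _ => ?_
    rw [hcal, mul_right_comm, ← groupExp_const_mul]
    simp only [mul_mul_mul_comm]
  rw [hquad]
  exact groupExp_nonneg (fun x => (hμpos x).le) Φ (fun _ => sq_nonneg _) x
end

section
/- Suppose responses are binary, 𝒴 = {0,1}, and the pair predictor p̂₂ is pair-calibrated with some grouping function Φ. Then for every x ∈ 𝒳 there exist real numbers m(x) ∈ [0,1] and ρ(x) ∈ [0,1] such that the 2×2 joint probability matrix P(x), with entries P(x)_{ij} = p̂₂(i,j|x) for i,j ∈ {0,1}, decomposes as P(x) = ρ(x)·[[1−m(x), 0],[0, m(x)]] + (1−ρ(x))·[[(1−m(x))², m(x)(1−m(x))],[m(x)(1−m(x)), m(x)²]]. -/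
open Finset

open scoped Classical

/-- Cauchy–Schwarz inequality for the group expectation. -/
theorem sq_groupExp_mul_le {𝒳 𝒵 : Type*} [Fintype 𝒳] {μ : 𝒳 → ℝ} (hμ : ∀ x, 0 ≤ μ x)
    (Φ : 𝒳 → 𝒵) (f g : 𝒳 → ℝ) (x : 𝒳) :
    groupExp μ Φ (fun x' => f x' * g x') x ^ 2 ≤
      groupExp μ Φ (fun x' => f x' * f x') x * groupExp μ Φ (fun x' => g x' * g x') x := by
  unfold groupExp
  rw [div_pow, div_mul_div_comm, ← sq (∑ x' : 𝒳, if Φ x' = Φ x then μ x' else 0)]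
  refine div_le_div_of_nonneg_right ?_ (sq_nonneg _)
  refine Finset.sum_sq_le_sum_mul_sum_of_sq_le_mul _ ?_ ?_ ?_ <;> intro x' _ <;> split_ifs
  · exact mul_nonneg (hμ x') (mul_self_nonneg _)
  · exact le_rfl
  · exact mul_nonneg (hμ x') (mul_self_nonneg _)
  · exact le_rfl
  · exact le_of_eq (by ring)
  · exact le_of_eq (by ring)

/-- A symmetric `2 × 2` probability matrix `[[a, b], [b, d]]` with nonnegative determinant is a
mixture of a perfectly correlated and an independent pair with the same marginals. -/
theorem exists_mixture_of_sq_le_mul {a b d : ℝ} (ha : 0 ≤ a) (hb : 0 ≤ b) (hd : 0 ≤ d)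
    (hsum : a + b + (b + d) = 1) (hdet : b ^ 2 ≤ a * d) :
    ∃ m ρ : ℝ, m ∈ Set.Icc (0 : ℝ) 1 ∧ ρ ∈ Set.Icc (0 : ℝ) 1 ∧
      a = ρ * (1 - m) + (1 - ρ) * (1 - m) ^ 2 ∧
      b = (1 - ρ) * (m * (1 - m)) ∧
      d = ρ * m + (1 - ρ) * m ^ 2 := by
  obtain rfl : a = 1 - 2 * b - d := by linarith
  have hv : b ≤ (b + d) * (1 - (b + d)) := by nlinarith
  have hv0 : 0 ≤ (b + d) * (1 - (b + d)) := hb.trans hv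
  have hcoef : b / ((b + d) * (1 - (b + d))) * ((b + d) * (1 - (b + d))) = b :=
    div_mul_cancel_of_imp fun h => le_antisymm (hv.trans_eq h) hb
  have hc0 := div_nonneg hb hv0
  have hc1 := div_le_one_of_le₀ hv hv0
  generalize b / ((b + d) * (1 - (b + d))) = c at hcoef hc0 hc1
  refine ⟨b + d, 1 - c, ⟨by linarith, by linarith⟩, ⟨by linarith, by linarith⟩, ?_, ?_, ?_⟩
  · linear_combination hcoef
  · linear_combination -hcoef
  · linear_combination hcoef

/-- For binary responses `𝒴 = {0,1}` (encoded as `Fin 2`), the joint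
probability matrix of a pair-calibrated pair predictor decomposes as a mixture
`ρ·diag(1−m, m) + (1−ρ)·[(1−m), m]ᵀ[(1−m), m]` with `m, ρ ∈ [0,1]`. -/
theorem stmt_18 {𝒳 𝒵 : Type*} [Fintype 𝒳] [Nonempty 𝒳]
    (μ : 𝒳 → ℝ) (hμpos : ∀ x, 0 < μ x) (hμsum : ∑ x, μ x = 1)
    (p : 𝒳 → Fin 2 → ℝ) (hp0 : ∀ x y, 0 ≤ p x y) (hp1 : ∀ x, ∑ y, p x y = 1)
    (p2 : 𝒳 → Fin 2 → Fin 2 → ℝ)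
    (hp20 : ∀ x y₁ y₂, 0 ≤ p2 x y₁ y₂) (hp21 : ∀ x, ∑ y₁, ∑ y₂, p2 x y₁ y₂ = 1)
    (Φ : 𝒳 → 𝒵)
    (hcal : ∀ x y₁ y₂, p2 x y₁ y₂ = groupExp μ Φ (fun x' => p x' y₁ * p x' y₂) x) :
    ∀ x : 𝒳, ∃ m ρ : ℝ, m ∈ Set.Icc (0 : ℝ) 1 ∧ ρ ∈ Set.Icc (0 : ℝ) 1 ∧
      p2 x 0 0 = ρ * (1 - m) + (1 - ρ) * (1 - m) ^ 2 ∧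
      p2 x 0 1 = (1 - ρ) * (m * (1 - m)) ∧
      p2 x 1 0 = (1 - ρ) * (m * (1 - m)) ∧
      p2 x 1 1 = ρ * m + (1 - ρ) * m ^ 2 := by
  intro x
  have hsymm : p2 x 1 0 = p2 x 0 1 := by simp only [hcal, mul_comm]
  have hdet : p2 x 0 1 ^ 2 ≤ p2 x 0 0 * p2 x 1 1 := by
    simpa only [hcal] using
      sq_groupExp_mul_le (fun x => (hμpos x).le) Φ (fun x' => p x' 0) (fun x' => p x' 1) x
  have hsum := hp21 x
  simp only [Fin.sum_univ_two, hsymm] at hsum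
  obtain ⟨m, ρ, hm, hρ, h00, h01, h11⟩ :=
    exists_mixture_of_sq_le_mul (hp20 x 0 0) (hp20 x 0 1) (hp20 x 1 1) hsum hdet
  exact ⟨m, ρ, hm, hρ, h00, h01, hsymm.trans h01, h11⟩
end
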